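/- arXiv:2209.00212 — 2 statements merged into one kernel-verified Lean document; each statement's English description precedes it below -/
import Mathlib

section
/- For every real p > 4, the series Σ_{i=1}^{∞} i · y_{2i−1,4i}^p converges, and moreover Σ_{i=1}^{∞} i · y_{2i−1,4i}^p ≤ (3/(2√(2π)))^p · Σ_{i=1}^{∞} i^{1−p/2}. -/
open MeasureTheory Filter

/-- The `n`-th Legendre polynomial, via Rodrigues formula:
`P_n(x) = (1/(2^n n!)) (d/dx)^n (x^2 - 1)^n`. -/
noncomputable def legP (n : ℕ) : ℝ → ℝ := fun x =>
  (1 / ((2 : ℝ) ^ n * (n.factorial : ℝ))) *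
    iteratedDeriv n (fun y : ℝ => (y ^ 2 - 1) ^ n) x

/-- Positive part of the `n`-th Legendre polynomial. -/
noncomputable def legPpos (n : ℕ) (x : ℝ) : ℝ := max (legP n x) 0

/-- Negative part of the `n`-th Legendre polynomial. -/
noncomputable def legPneg (n : ℕ) (x : ℝ) : ℝ := max (-legP n x) 0

open Polynomial in
noncomputable def lpoly (n : ℕ) : ℝ[X] :=
  C (1 / ((2 : ℝ) ^ n * (n.factorial : ℝ))) * derivative^[n] ((X ^ 2 - 1) ^ n)

open Polynomial in
lemma iterDeriv_poly (p : ℝ[X]) (n : ℕ) :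
    iteratedDeriv n (fun x => p.eval x) = fun x => (derivative^[n] p).eval x := by
  induction n with
  | zero => simp
  | succ n ih =>
    rw [iteratedDeriv_succ, ih]
    funext x
    rw [Polynomial.deriv, Function.iterate_succ_apply']

lemma legP_eq (n : ℕ) (x : ℝ) : legP n x = (lpoly n).eval x := by
  have h := iterDeriv_poly ((Polynomial.X ^ 2 - 1) ^ n) n
  simp only [Polynomial.eval_pow, Polynomial.eval_sub, Polynomial.eval_X, Polynomial.eval_one] at h
  simp [legP, lpoly, h]

open Polynomial in
lemma ode_aux (n k : ℕ) :
    (X ^ 2 - 1) * derivative^[k + 2] ((X ^ 2 - 1 : ℝ[X]) ^ n)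
      + C (2 * ((k:ℝ) + 1 - n)) * X * derivative^[k + 1] ((X ^ 2 - 1 : ℝ[X]) ^ n)
      + C (((k:ℝ) + 1) * (k - 2 * n)) * derivative^[k] ((X ^ 2 - 1 : ℝ[X]) ^ n) = 0 := by
  induction k with
  | zero =>
    have h0 : (X ^ 2 - 1) * derivative ((X ^ 2 - 1 : ℝ[X]) ^ n)
        = C (2 * (n:ℝ)) * X * (X ^ 2 - 1 : ℝ[X]) ^ n := by
      rcases n with _ | n
      · simp
      · rw [derivative_pow_succ]
        simp only [C_mul, map_ofNat, map_natCast, derivative_sub, derivative_X_pow, derivative_one, Nat.cast_add, Nat.cast_one, Nat.cast_ofNat, C_add, map_one]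
        ring
    have h1 := congrArg derivative h0
    simp only [derivative_mul, derivative_sub, derivative_X_pow, derivative_one, derivative_C,
      derivative_X] at h1
    simp only [Function.iterate_succ_apply', Function.iterate_zero, id, zero_add] at h1 ⊢
    simp only [C_mul, C_add, C_sub, Nat.cast_zero, map_zero, map_one, map_ofNat, map_natCast,
      Nat.cast_ofNat] at h1 ⊢
    linear_combination h1
  | succ k ih =>
    have h1 := congrArg derivative ih
    simp only [derivative_mul, derivative_sub, derivative_add, derivative_X_pow, derivative_one,
      derivative_C, derivative_X, ← Function.iterate_succ_apply' derivative] at h1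
    simp only [C_mul, C_add, C_sub, Nat.cast_zero, map_zero, map_one, map_ofNat, map_natCast,
      Nat.cast_ofNat, Nat.cast_add, Nat.cast_one, Nat.succ_eq_add_one] at h1 ⊢
    linear_combination h1

open Polynomial in
lemma ode_poly (n : ℕ) :
    (X ^ 2 - 1) * derivative (derivative (lpoly n)) + 2 * X * derivative (lpoly n)
      - C ((n:ℝ) * (n + 1)) * lpoly n = 0 := by
  have h := ode_aux n n
  simp only [lpoly, derivative_C_mul, ← Function.iterate_succ_apply' derivative]
  simp only [C_mul, C_add, C_sub, Nat.cast_zero, map_zero, map_one, map_ofNat, map_natCast,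
      Nat.cast_ofNat, Nat.cast_add, Nat.cast_one, Nat.succ_eq_add_one] at h ⊢
  linear_combination (C (1 / ((2 : ℝ) ^ n * (n.factorial : ℝ)))) * h

open Polynomial in
lemma lpoly_coeff_rec (n j : ℕ) :
    ((j:ℝ) + 2) * (j + 1) * (lpoly n).coeff (j + 2) = ((j:ℝ) * (j + 1) - n * (n + 1)) * (lpoly n).coeff j := by
  have h := congrArg (fun q => coeff q j) (ode_poly n)
  have e : (X ^ 2 - 1) * derivative (derivative (lpoly n)) + 2 * X * derivative (lpoly n)
      - C ((n:ℝ) * (n + 1)) * lpoly n = X * (X * derivative (derivative (lpoly n)))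
       - derivative (derivative (lpoly n)) + C 2 * (X * derivative (lpoly n))
      - C ((n:ℝ) * (n + 1)) * lpoly n := by
    simp only [map_ofNat]; ring
  rw [e] at h
  simp only [coeff_sub, coeff_add, coeff_C_mul, coeff_zero] at h
  rcases j with _ | _ | j
  · simp [coeff_derivative] at h ⊢; linarith
  · simp [coeff_derivative, coeff_X_mul] at h ⊢; linarith
  · simp only [coeff_X_mul, coeff_derivative] at h; push_cast at h ⊢; linarith

open Polynomial in
lemma base_coeff (n j : ℕ) : ((X ^ 2 - 1 : ℝ[X]) ^ n).coeff j =
    if 2 ∣ j then (-1) ^ (n - j / 2) * (n.choose (j / 2) : ℝ) else 0 := by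
  have : (X ^ 2 - 1 : ℝ[X]) ^ n = expand ℝ 2 ((X + C (-1)) ^ n) := by
    simp [sub_eq_add_neg]
  rw [this, coeff_expand (by norm_num)]
  simp only [coeff_X_add_C_pow]

open Polynomial in
lemma lpoly_odd (m j : ℕ) : (lpoly (2 * m)).coeff (2 * j + 1) = 0 := by
  rw [lpoly, coeff_C_mul, coeff_iterate_derivative, base_coeff, if_neg (by omega)]
  simp

open Polynomial in
lemma lpoly_zero (i : ℕ) : (lpoly (4 * i)).coeff 0 = ((4 * i).choose (2 * i) : ℝ) / 2 ^ (4 * i) := by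
  rw [lpoly, coeff_C_mul, coeff_iterate_derivative, base_coeff, if_pos (by omega)]
  have h1 : (0 + 4 * i) / 2 = 2 * i := by omega
  have h2 : 4 * i - 2 * i = 2 * i := by omega
  rw [h1, h2, zero_add, Nat.descFactorial_self, pow_mul]
  have : ((4 * i).factorial : ℝ) ≠ 0 := by positivity
  simp
  field_simp

open Polynomial in
lemma lpoly_deg (n : ℕ) : (lpoly n).natDegree ≤ n := by
  refine (natDegree_C_mul_le _ _).trans ((natDegree_iterate_derivative _ _).trans ?_)
  have : ((X ^ 2 - 1 : ℝ[X]) ^ n).natDegree ≤ n * 2 := by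
    refine natDegree_pow_le_of_le n ?_
    compute_degree
  omega

lemma choose_bound (i : ℕ) (hi : 1 ≤ i) :
    ((4 * i).choose (2 * i) : ℝ) / 2 ^ (4 * i) ≤ 1 / Real.sqrt (2 * Real.pi * i) := by
  have hpi := Real.pi_pos
  have hi' : (1:ℝ) ≤ i := by exact_mod_cast hi
  have hw := Real.Wallis.le_W (2 * i)
  rw [Real.Wallis.W_eq_factorial_ratio] at hw
  have hc : ((4 * i).choose (2 * i) : ℝ) * ((2*i).factorial : ℝ)^2 = ((2 * (2 * i)).factorial : ℝ) := by
    have := Nat.choose_mul_factorial_mul_factorial (n := 4 * i) (k := 2 * i) (by omega)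
    rw [show 4 * i - 2 * i = 2 * i by omega] at this
    rw [show 2 * (2 * i) = 4 * i by omega, ← this]; push_cast; ring
  have hf : (0:ℝ) < ((2*i).factorial : ℝ) := by positivity
  have hC : (0:ℝ) < ((4 * i).choose (2 * i) : ℝ) := by exact_mod_cast Nat.choose_pos (by omega)
  rw [← hc] at hw
  set c : ℝ := ((4 * i).choose (2 * i) : ℝ)
  set F : ℝ := ((2*i).factorial : ℝ)
  have e : (2:ℝ) ^ (4 * (2 * i)) = (2 ^ (4 * i)) ^ 2 := by rw [← pow_mul]; congr 1; ring
  rw [e] at hw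
  set T : ℝ := 2 ^ (4 * i)
  have hT : 0 < T := by positivity
  push_cast at hw
  have hw2 : 2 * Real.pi * i * c ^ 2 ≤ T ^ 2 := by
    rw [le_div_iff₀ (by positivity)] at hw
    have h3 : (2 * (2 * (i:ℝ)) + 1) / (2 * (2 * i) + 2) * (Real.pi / 2) * (c ^ 2 * (2 * (2 * i) + 1)) ≤ T ^ 2 := by
      have hF4 : 0 < F ^ 4 := by positivity
      refine le_of_mul_le_mul_right ?_ hF4
      calc _ = _ := by ring
        _ ≤ _ := hw
    refine le_trans ?_ h3
    have : 2 * (i:ℝ) ≤ (2 * (2 * (i:ℝ)) + 1) / (2 * (2 * i) + 2) * (1 / 2) * (2 * (2 * i) + 1) := by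
      rw [div_mul_eq_mul_div, div_mul_eq_mul_div, le_div_iff₀ (by positivity)]
      nlinarith
    calc 2 * Real.pi * i * c ^ 2 = (2 * i) * (Real.pi * c ^ 2) := by ring
      _ ≤ _ := mul_le_mul_of_nonneg_right this (by positivity)
      _ = _ := by ring
  rw [div_le_div_iff₀ hT (by positivity), one_mul]
  refine le_of_sq_le_sq ?_ hT.le
  rw [mul_pow, Real.sq_sqrt (by positivity)]
  linarith

lemma sonin (f f' f'' : ℝ → ℝ) (N : ℝ) (hN : 0 ≤ N)
    (h1 : ∀ x, HasDerivAt f (f' x) x) (h2 : ∀ x, HasDerivAt f' (f'' x) x)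
    (hode : ∀ x, (x ^ 2 - 1) * f'' x + 2 * x * f' x - N * f x = 0) (h0 : f' 0 = 0)
    (x : ℝ) (hx0 : 0 ≤ x) (hx1 : x < 1) :
    Real.sqrt (1 - x ^ 2) * f x ^ 2 ≤ f 0 ^ 2 := by
  set E : ℝ → ℝ := fun x => Real.sqrt (1 - x ^ 2) *
    (f x ^ 2 + 4 * ((1 - x ^ 2) * f' x - x / 2 * f x) ^ 2 / ((4 * N + 1) * (1 - x ^ 2) + 1)) with hE
  have hD : ∀ x ∈ Set.Ico (0:ℝ) 1, HasDerivAt E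
      (-8 * x * ((1 - x ^ 2) * f' x - x / 2 * f x) ^ 2 /
        (Real.sqrt (1 - x ^ 2) * ((4 * N + 1) * (1 - x ^ 2) + 1) ^ 2)) x := by
    intro x hx
    have hs : 0 < 1 - x ^ 2 := by nlinarith [hx.1, hx.2]
    have hDp : 0 < (4 * N + 1) * (1 - x ^ 2) + 1 := by positivity
    have hq : HasDerivAt (fun x : ℝ => 1 - x ^ 2) (-(2 * x)) x := by
      have := (hasDerivAt_pow 2 x).const_sub 1
      simpa using this
    have hA : HasDerivAt (fun x => (1 - x ^ 2) * f' x - x / 2 * f x)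
        ((-(2 * x)) * f' x + (1 - x ^ 2) * f'' x - (1 / 2 * f x + x / 2 * f' x)) x :=
      (hq.mul (h2 x)).sub (((hasDerivAt_id x).div_const 2).mul (h1 x))
    have hDd : HasDerivAt (fun x : ℝ => (4 * N + 1) * (1 - x ^ 2) + 1) ((4 * N + 1) * (-(2 * x))) x :=
      (hq.const_mul _).add_const 1
    have hH := ((h1 x).pow 2).add (((hA.pow 2).const_mul 4).div hDd hDp.ne')
    have hT := (hq.sqrt hs.ne').mul hH
    refine hT.congr_deriv ?_
    have hf'' : f'' x = (2 * x * f' x - N * f x) / (1 - x ^ 2) := by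
      rw [eq_div_iff hs.ne']; linarith [hode x]
    have hsq : Real.sqrt (1 - x ^ 2) ^ 2 = 1 - x ^ 2 := Real.sq_sqrt hs.le
    have hsp : 0 < Real.sqrt (1 - x ^ 2) := Real.sqrt_pos.mpr hs
    have hxf : (1 - x ^ 2) * f'' x = 2 * x * f' x - N * f x := by linarith [hode x]
    rw [hxf]
    simp only [Pi.add_apply, Pi.pow_apply, Pi.mul_apply, Pi.div_apply]
    set s := Real.sqrt (1 - x ^ 2)
    generalize f x = a at *
    generalize f' x = b at *
    rw [← hsq] at hDp ⊢
    have hx2 : x ^ 2 = 1 - s ^ 2 := by linarith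
    field_simp
    have hx3 : x ^ 3 = x * (1 - s ^ 2) := by rw [← hx2]; ring
    have hx4 : x ^ 4 = (1 - s ^ 2) ^ 2 := by rw [← hx2]; ring
    have hx5 : x ^ 5 = x * (1 - s ^ 2) ^ 2 := by rw [← hx2]; ring
    push_cast
    ring_nf
    simp only [hx2, hx3, hx4, hx5]
    ring
  have hanti : AntitoneOn E (Set.Ico 0 1) := by
    apply antitoneOn_of_deriv_nonpos (convex_Ico 0 1)
    · exact fun x hx => (hD x hx).continuousAt.continuousWithinAt
    · exact fun x hx => (hD x (interior_subset hx)).differentiableAt.differentiableWithinAt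
    · intro x hx
      have hx := interior_subset hx
      rw [(hD x hx).deriv]
      apply div_nonpos_of_nonpos_of_nonneg
      · nlinarith [mul_nonneg hx.1 (sq_nonneg ((1 - x ^ 2) * f' x - x / 2 * f x))]
      · positivity
  have h := hanti (by simp) ⟨hx0, hx1⟩ hx0
  have e0 : E 0 = f 0 ^ 2 := by simp [hE, h0]
  rw [e0] at h
  refine le_trans ?_ h
  simp only [hE]
  apply mul_le_mul_of_nonneg_left _ (Real.sqrt_nonneg _)
  have hs : 0 < 1 - x ^ 2 := by nlinarith
  have : 0 ≤ 4 * ((1 - x ^ 2) * f' x - x / 2 * f x) ^ 2 / ((4 * N + 1) * (1 - x ^ 2) + 1) := by positivity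
  linarith

open Polynomial in
lemma prod_coeffs {ι : Type*} [DecidableEq ι] (s : Finset ι) (w : ι → ℝ) :
    (∏ k ∈ s, (1 - C (w k) * X)).coeff 0 = 1 ∧
    (∏ k ∈ s, (1 - C (w k) * X)).coeff 1 = - ∑ k ∈ s, w k ∧
    2 * (∏ k ∈ s, (1 - C (w k) * X)).coeff 2 = (∑ k ∈ s, w k) ^ 2 - ∑ k ∈ s, w k ^ 2 := by
  induction s using Finset.induction_on with
  | empty => simp [coeff_one]
  | insert a s ha ih =>
    obtain ⟨i0, i1, i2⟩ := ih
    rw [Finset.prod_insert ha, Finset.sum_insert ha, Finset.sum_insert ha]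
    have e : ∀ q : ℝ[X], (1 - C (w a) * X) * q = q - C (w a) * (X * q) := fun q => by ring
    rw [e]
    simp only [coeff_sub, coeff_C_mul, coeff_X_mul, coeff_X_mul_zero]
    rw [i0, i1]
    refine ⟨by ring, by ring, ?_⟩
    rw [mul_sub, i2]; ring

lemma arith_contra (m W p1 p2 N : ℝ) (hm : 1 ≤ m) (hN : N = (2 * m + 2) * (2 * m + 3))
    (h1 : W + p1 = N / 2) (h2 : W ^ 2 + p2 = N ^ 2 / 6 + N / 2)
    (hp1 : p1 ≤ m * (81 / 65)) (hp2 : m ≤ p2) : False := by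
  have hW : 2 * m ^ 2 + 5 * m + 3 - m * (81 / 65) ≤ W := by
    rw [hN] at h1; nlinarith
  have hW2 : (2 * m ^ 2 + 5 * m + 3 - m * (81 / 65)) ^ 2 ≤ W ^ 2 := by
    apply pow_le_pow_left₀ _ hW
    nlinarith
  have h3 : W ^ 2 ≤ N ^ 2 / 6 + N / 2 - m := by linarith
  rw [hN] at h3
  have h4 := hW2.trans h3
  obtain ⟨t, rfl⟩ : ∃ t, m = 1 + t := ⟨m - 1, by ring⟩
  have ht : 0 ≤ t := by linarith
  ring_nf at h4
  nlinarith [pow_nonneg ht 2, pow_nonneg ht 3, pow_nonneg ht 4]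

open Polynomial in
lemma zero_loc (i : ℕ) (hi : 1 ≤ i) (z : ℕ → ℝ)
    (hz : ∀ k, 1 ≤ k → k ≤ 2 * i → z k ∈ Set.Ioo (0:ℝ) 1 ∧ (lpoly (4 * i)).eval (z k) = 0)
    (hanti : ∀ k l, 1 ≤ k → k < l → l ≤ 2 * i → z l < z k) :
    z (2 * i - 1) ^ 2 ≤ 65 / 81 := by
  by_contra hcon
  push Not at hcon
  set P := lpoly (4 * i) with hP
  set Q := contract 2 P with hQ
  have hPQ : P = expand ℝ 2 Q := by
    ext j
    rw [coeff_expand (by norm_num), coeff_contract (by norm_num)]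
    split_ifs with h
    · rw [Nat.div_mul_cancel h]
    · obtain ⟨r, rfl⟩ : ∃ r, j = 2 * r + 1 := ⟨j / 2, by omega⟩
      have := lpoly_odd (2 * i) r
      rwa [show 2 * (2 * i) = 4 * i by ring] at this
  have hQdeg : Q.natDegree ≤ 2 * i := by
    have h := lpoly_deg (4 * i)
    rw [← hP, hPQ, natDegree_expand] at h
    omega
  set a0 := P.coeff 0 with ha0
  have ha0p : 0 < a0 := by
    rw [ha0, hP, lpoly_zero]
    have : (0:ℝ) < ((4 * i).choose (2 * i) : ℝ) := by exact_mod_cast Nat.choose_pos (by omega)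
    positivity
  have hQ0 : Q.coeff 0 = a0 := by rw [hQ, coeff_contract (by norm_num)]
  have hQ1 : Q.coeff 1 = P.coeff 2 := by rw [hQ, coeff_contract (by norm_num)]
  have hQ2 : Q.coeff 2 = P.coeff 4 := by rw [hQ, coeff_contract (by norm_num)]
  have r0 := lpoly_coeff_rec (4 * i) 0
  have r2 := lpoly_coeff_rec (4 * i) 2
  rw [← hP] at r0 r2
  set S := Finset.Icc 1 (2 * i) with hS
  set w : ℕ → ℝ := fun k => 1 / z k ^ 2 with hw
  set R : ℝ[X] := C a0 * ∏ k ∈ S, (1 - C (w k) * X) with hR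
  have hzp : ∀ k ∈ S, 0 < z k := fun k hk => (hz k (Finset.mem_Icc.1 hk).1 (Finset.mem_Icc.1 hk).2).1.1
  have hz1 : ∀ k ∈ S, z k < 1 := fun k hk => (hz k (Finset.mem_Icc.1 hk).1 (Finset.mem_Icc.1 hk).2).1.2
  have hinj : Set.InjOn (fun k => z k ^ 2) S := by
    intro k hk l hl h
    have hk' := Finset.mem_Icc.1 hk
    have hl' := Finset.mem_Icc.1 hl
    have h' : z k = z l := (pow_left_inj₀ (hzp k hk).le (hzp l hl).le (by norm_num)).1 h
    rcases lt_trichotomy k l with h1 | h1 | h1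
    · have := hanti k l hk'.1 h1 hl'.2; linarith
    · exact h1
    · have := hanti l k hl'.1 h1 hk'.2; linarith
  have hRdeg : R.natDegree ≤ 2 * i := by
    refine (natDegree_C_mul_le _ _).trans ?_
    refine (natDegree_prod_le _ _).trans ?_
    calc ∑ k ∈ S, (1 - C (w k) * X : ℝ[X]).natDegree ≤ ∑ k ∈ S, 1 := by
          apply Finset.sum_le_sum
          intro k _
          compute_degree
      _ = 2 * i := by simp [hS]
  have h0T : (0:ℝ) ∉ S.image (fun k => z k ^ 2) := by
    intro h
    obtain ⟨k, hk, h⟩ := Finset.mem_image.1 h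
    have := hzp k hk
    exact absurd h (by positivity)
  have hcard : (insert (0:ℝ) (S.image (fun k => z k ^ 2))).card = 2 * i + 1 := by
    rw [Finset.card_insert_of_notMem h0T, Finset.card_image_of_injOn hinj]
    simp [hS]
  have hQR : Q = R := by
    apply eq_of_degrees_lt_of_eval_finset_eq (insert (0:ℝ) (S.image (fun k => z k ^ 2)))
    · rw [hcard]
      exact lt_of_le_of_lt (degree_le_of_natDegree_le hQdeg) (by exact_mod_cast Nat.lt_succ_self _)
    · rw [hcard]
      exact lt_of_le_of_lt (degree_le_of_natDegree_le hRdeg) (by exact_mod_cast Nat.lt_succ_self _)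
    · intro x hx
      rcases Finset.mem_insert.1 hx with rfl | hx
      · rw [← coeff_zero_eq_eval_zero, ← coeff_zero_eq_eval_zero, hQ0, hR, coeff_C_mul,
          (prod_coeffs S w).1, mul_one]
      · obtain ⟨k, hk, rfl⟩ := Finset.mem_image.1 hx
        have hk' := Finset.mem_Icc.1 hk
        have e1 : Q.eval (z k ^ 2) = 0 := by
          rw [← (hz k hk'.1 hk'.2).2, hPQ, expand_eval]
        rw [e1, hR, eval_mul, eval_prod]
        symm
        apply mul_eq_zero_of_right
        apply Finset.prod_eq_zero hk
        have := hzp k hk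
        simp [hw]
        field_simp
        simp
  obtain ⟨-, c1, c2⟩ := prod_coeffs S w
  have q1 : Q.coeff 1 = a0 * - ∑ k ∈ S, w k := by rw [hQR, hR, coeff_C_mul, c1]
  have q2 : 2 * Q.coeff 2 = a0 * ((∑ k ∈ S, w k) ^ 2 - ∑ k ∈ S, w k ^ 2) := by
    rw [hQR, hR, coeff_C_mul, ← c2]; ring
  set s1 := ∑ k ∈ S, w k with hs1
  set s2 := ∑ k ∈ S, w k ^ 2 with hs2
  rw [← ha0] at r0
  set N : ℝ := ((4 * i : ℕ) : ℝ) * (((4 * i : ℕ) : ℝ) + 1) with hN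
  have r0' : 2 * P.coeff 2 = -N * a0 := by
    simp only [Nat.cast_zero, zero_add] at r0
    linarith
  have r2' : 12 * P.coeff 4 = (6 - N) * P.coeff 2 := by
    simp only [Nat.cast_ofNat, Nat.reduceAdd] at r2
    linarith
  rw [← hQ1, q1] at r0'
  rw [← hQ2, ← hQ1, q1] at r2'
  have S1 : s1 = N / 2 := by
    apply mul_left_cancel₀ ha0p.ne'; linarith
  have S2 : s2 = N ^ 2 / 6 + N / 2 := by
    apply mul_left_cancel₀ ha0p.ne'
    have hr2 : 6 * (a0 * (s1 ^ 2 - s2)) = (6 - N) * (a0 * -s1) := by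
      rw [← q2]; linarith
    rw [S1] at hr2
    linear_combination (-1/6) * hr2
  have hlast : S = insert (2 * i) (Finset.Icc 1 (2 * i - 1)) := by
    ext k; simp [hS]; omega
  have hnot : 2 * i ∉ Finset.Icc 1 (2 * i - 1) := by simp; omega
  rw [hs1, hlast, Finset.sum_insert hnot] at S1
  rw [hs2, hlast, Finset.sum_insert hnot] at S2
  have hi' : (1:ℝ) ≤ i := by exact_mod_cast hi
  have hsub : ∀ k ∈ Finset.Icc 1 (2 * i - 1), k ∈ S := fun k hk => by
    rw [hlast]; exact Finset.mem_insert_of_mem hk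
  have hcastm : (((2 * i - 1 : ℕ)) : ℝ) = 2 * i - 1 := by
    rw [Nat.cast_sub (by omega)]; push_cast; ring
  refine arith_contra (2 * i - 1) (w (2 * i)) _ _ N (by linarith) (by push_cast [hN]; ring) S1 S2 ?_ ?_
  · have : ∀ k ∈ Finset.Icc 1 (2 * i - 1), w k ≤ 81 / 65 := by
      intro k hk
      have hp := hzp k (hsub k hk)
      have hk' := Finset.mem_Icc.1 hk
      have hge : z (2 * i - 1) ≤ z k := by
        rcases hk'.2.lt_or_eq with h | h
        · exact (hanti k _ hk'.1 h (by omega)).le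
        · rw [h]
      have hp2 := hzp (2 * i - 1) (by rw [hS, Finset.mem_Icc]; omega)
      have : 65 / 81 < z k ^ 2 := lt_of_lt_of_le hcon (pow_le_pow_left₀ hp2.le hge 2)
      simp only [hw]
      rw [div_le_iff₀ (by positivity)]
      linarith
    have h := Finset.sum_le_card_nsmul _ _ _ this
    simp only [Nat.card_Icc, nsmul_eq_mul, Nat.add_sub_cancel] at h
    rwa [hcastm] at h
  · have : ∀ k ∈ Finset.Icc 1 (2 * i - 1), 1 ≤ w k ^ 2 := by
      intro k hk
      have hp := hzp k (hsub k hk)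
      have hp1 := hz1 k (hsub k hk)
      apply one_le_pow₀
      simp only [hw]
      rw [le_div_iff₀ (by positivity)]
      nlinarith
    have h := Finset.card_nsmul_le_sum _ _ _ this
    simp only [Nat.card_Icc, nsmul_eq_mul, Nat.add_sub_cancel, mul_one] at h
    rwa [hcastm] at h

open Polynomial in
lemma legP_bound (i : ℕ) (hi : 1 ≤ i) (x : ℝ) (hx0 : 0 ≤ x) (hx : x ^ 2 ≤ 65 / 81) :
    |legP (4 * i) x| ≤ 3 / (2 * Real.sqrt (2 * Real.pi)) / Real.sqrt i := by
  have hx1 : x < 1 := by nlinarith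
  have h := sonin (fun x => (lpoly (4 * i)).eval x) (fun x => (derivative (lpoly (4 * i))).eval x)
    (fun x => (derivative (derivative (lpoly (4 * i)))).eval x)
    (((4 * i : ℕ) : ℝ) * (((4 * i : ℕ) : ℝ) + 1)) (by positivity)
    (fun x => Polynomial.hasDerivAt _ x) (fun x => Polynomial.hasDerivAt _ x)
    (fun x => by
      have := congrArg (eval x) (ode_poly (4 * i))
      simpa only [eval_sub, eval_add, eval_mul, eval_pow, eval_X, eval_one, eval_C, eval_ofNat, eval_zero] using this)
    (by
      have := lpoly_odd (2 * i) 0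
      rw [show 2 * (2 * i) = 4 * i by ring] at this
      simp only [← coeff_zero_eq_eval_zero, coeff_derivative]
      simp at this
      simp [this])
    x hx0 hx1
  simp only [← coeff_zero_eq_eval_zero] at h
  rw [← legP_eq] at h
  have hb := choose_bound i hi
  rw [← lpoly_zero] at hb
  have hc0 : 0 ≤ (lpoly (4 * i)).coeff 0 := by rw [lpoly_zero]; positivity
  have hs : 4 / 9 ≤ Real.sqrt (1 - x ^ 2) := by
    apply Real.le_sqrt_of_sq_le; norm_num; linarith
  have h2 : |legP (4 * i) x| ≤ 3 / 2 * (lpoly (4 * i)).coeff 0 := by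
    apply abs_le_of_sq_le_sq _ (by positivity)
    nlinarith [mul_le_mul_of_nonneg_right hs (sq_nonneg (legP (4 * i) x))]
  refine h2.trans ?_
  rw [Real.sqrt_mul (by positivity)] at hb
  calc _ ≤ 3 / 2 * _ := mul_le_mul_of_nonneg_left hb (by norm_num)
    _ = _ := by field_simp

/-- For $p > 4$, the series $Σ_{i≥1} i\, y_{2i-1,4i}^p$ converges and is at most
$(3/(2√(2π)))^p Σ_{i≥1} i^{1-p/2}$, where for each $i$, $z_i$ enumerates the zeros
of $P_{4i}$ in $(0,1)$ in decreasing order and $y_i = y_{2i-1,4i}$ is the sup of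
$|P_{4i}|$ on $[z_{2i,4i}, z_{2i-1,4i}]$. -/
theorem summable_extremal_series (p : ℝ) (hp : 4 < p)
    (z : ℕ → ℕ → ℝ)
    (hzmem : ∀ i, 1 ≤ i → ∀ k, 1 ≤ k → k ≤ 2 * i →
      z i k ∈ Set.Ioo (0:ℝ) 1 ∧ legP (4 * i) (z i k) = 0)
    (hzanti : ∀ i, 1 ≤ i → ∀ k l, 1 ≤ k → k < l → l ≤ 2 * i → z i l < z i k)
    (hzall : ∀ i, 1 ≤ i → ∀ x ∈ Set.Ioo (0:ℝ) 1, legP (4 * i) x = 0 →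
      ∃ k, 1 ≤ k ∧ k ≤ 2 * i ∧ x = z i k)
    (y : ℕ → ℝ)
    (hy : ∀ i, 1 ≤ i →
      IsLUB ((fun x => |legP (4 * i) x|) '' Set.Icc (z i (2 * i)) (z i (2 * i - 1))) (y i)) :
    Summable (fun i : ℕ => ((i : ℝ) + 1) * (y (i + 1)) ^ p) ∧
      ∑' i : ℕ, ((i : ℝ) + 1) * (y (i + 1)) ^ p ≤
        (3 / (2 * Real.sqrt (2 * Real.pi))) ^ p *
          ∑' i : ℕ, ((i : ℝ) + 1) ^ (1 - p / 2) := by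
  set K : ℝ := 3 / (2 * Real.sqrt (2 * Real.pi)) with hK
  have hK0 : 0 ≤ K := by positivity
  have hyb : ∀ i, 1 ≤ i → 0 ≤ y i ∧ y i ≤ K / Real.sqrt i := by
    intro i hi
    have hzl : z i (2 * i) < z i (2 * i - 1) := hzanti i hi _ _ (by omega) (by omega) le_rfl
    have hloc := zero_loc i hi (z i)
      (fun k h1 h2 => by rw [← legP_eq]; exact hzmem i hi k h1 h2) (hzanti i hi)
    have hpos := (hzmem i hi (2 * i) (by omega) le_rfl).1.1
    constructor
    · exact (abs_nonneg _).trans ((hy i hi).1 ⟨z i (2 * i), ⟨le_rfl, hzl.le⟩, rfl⟩)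
    · apply (hy i hi).2
      rintro _ ⟨x, hx, rfl⟩
      exact legP_bound i hi x (hpos.le.trans hx.1)
        ((pow_le_pow_left₀ (hpos.le.trans hx.1) hx.2 2).trans hloc)
  have hS : Summable (fun i : ℕ => ((i : ℝ) + 1) ^ (1 - p / 2)) := by
    have h := (summable_nat_add_iff 1).2 (Real.summable_nat_rpow (p := 1 - p / 2).2 (by linarith))
    simpa using h
  have hterm : ∀ i : ℕ, ((i : ℝ) + 1) * (y (i + 1)) ^ p ≤ K ^ p * ((i : ℝ) + 1) ^ (1 - p / 2) := by
    intro i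
    obtain ⟨h0, h1⟩ := hyb (i + 1) (by omega)
    push_cast at h1
    have hi : (0:ℝ) < (i:ℝ) + 1 := by positivity
    have h2 := Real.rpow_le_rpow h0 h1 (by linarith : 0 ≤ p)
    rw [Real.div_rpow hK0 (Real.sqrt_nonneg _), Real.sqrt_eq_rpow, ← Real.rpow_mul hi.le] at h2
    calc _ ≤ ((i : ℝ) + 1) * (K ^ p / ((i:ℝ) + 1) ^ (1 / 2 * p)) :=
          mul_le_mul_of_nonneg_left h2 hi.le
      _ = _ := by
        rw [Real.rpow_sub hi, Real.rpow_one, show 1 / 2 * p = p / 2 by ring]; ring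
  have hnn : ∀ i : ℕ, 0 ≤ ((i : ℝ) + 1) * (y (i + 1)) ^ p := fun i =>
    mul_nonneg (by positivity) (Real.rpow_nonneg (hyb (i + 1) (by omega)).1 p)
  have hsum := Summable.of_nonneg_of_le hnn hterm (hS.mul_left _)
  refine ⟨hsum, ?_⟩
  rw [← tsum_mul_left]
  exact hsum.tsum_le_tsum hterm (hS.mul_left _)
end

section
/- The series Σ_{i=1}^{∞} i·|J₀(j_{2i−1})|⁶ converges and satisfies Σ_{i=1}^{∞} i·|J₀(j_{2i−1})|⁶ < 2/(21π²). -/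
/-- The Bessel function of the first kind of order 0. -/
noncomputable def besselJ0 (x : ℝ) : ℝ :=
  ∑' k : ℕ, (-1 : ℝ) ^ k * (x / 2) ^ (2 * k) / ((k.factorial : ℝ)) ^ 2

/-- The Bessel function of the first kind of order 1. -/
noncomputable def besselJ1 (x : ℝ) : ℝ :=
  ∑' k : ℕ, (-1 : ℝ) ^ k * (x / 2) ^ (2 * k + 1) /
    ((k.factorial : ℝ) * ((k + 1).factorial : ℝ))

lemma aux_summable (a : ℕ → ℝ) (ha : ∀ n, |a n| ≤ 1 / (n.factorial : ℝ)) (y : ℝ) :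
    Summable (fun n => a n * y ^ n) := by
  refine Summable.of_norm_bounded (Real.summable_pow_div_factorial |y|) (fun n => ?_)
  rw [Real.norm_eq_abs, abs_mul, abs_pow]
  calc |a n| * |y| ^ n ≤ 1 / (n.factorial : ℝ) * |y| ^ n := by gcongr; exact ha n
    _ = _ := by ring

lemma aux_deriv (a : ℕ → ℝ) (ha : ∀ n, |a n| ≤ 1 / (n.factorial : ℝ)) (y : ℝ) :
    HasDerivAt (fun z => ∑' n, a n * z ^ n) (∑' n : ℕ, ((n : ℝ) + 1) * a (n + 1) * y ^ n) y := by
  set R := |y| + 1 with hR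
  have hR0 : 0 ≤ R := by positivity
  have hu : Summable (fun n : ℕ => (n : ℝ) * R ^ (n - 1) / (n.factorial : ℝ)) := by
    rw [← summable_nat_add_iff 1]
    refine (Real.summable_pow_div_factorial R).congr (fun n => ?_)
    rw [Nat.factorial_succ]
    push_cast
    have : ((n : ℝ) + 1) ≠ 0 := by positivity
    have h2 : (n.factorial : ℝ) ≠ 0 := by positivity
    try simp only [Nat.add_sub_cancel]
    field_simp
  have hb : ∀ n : ℕ, ∀ z ∈ Metric.ball (0 : ℝ) R,
      ‖a n * ((n : ℝ) * z ^ (n - 1))‖ ≤ (n : ℝ) * R ^ (n - 1) / (n.factorial : ℝ) := by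
    intro n z hz
    have hz' : |z| ≤ R := by
      have := mem_ball_zero_iff.1 hz
      rw [Real.norm_eq_abs] at this; exact this.le
    rw [Real.norm_eq_abs, abs_mul, abs_mul, abs_pow, Nat.abs_cast]
    calc |a n| * ((n : ℝ) * |z| ^ (n - 1))
        ≤ 1 / (n.factorial : ℝ) * ((n : ℝ) * R ^ (n - 1)) := by
          gcongr; exact ha n
      _ = _ := by ring
  have hy : y ∈ Metric.ball (0 : ℝ) R := by
    rw [mem_ball_zero_iff, Real.norm_eq_abs]; linarith
  have key := hasDerivAt_tsum_of_isPreconnected (g := fun n z => a n * z ^ n)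
    (g' := fun n z => a n * ((n : ℝ) * z ^ (n - 1))) hu Metric.isOpen_ball
    (convex_ball (0 : ℝ) R).isPreconnected
    (fun n z _ => (hasDerivAt_pow n z).const_mul (a n)) hb hy (aux_summable a ha y) hy
  refine key.congr_deriv ?_
  have hs : Summable (fun n : ℕ => a n * ((n : ℝ) * y ^ (n - 1))) :=
    Summable.of_norm_bounded hu (fun n => hb n y hy)
  rw [hs.tsum_eq_zero_add]
  simp only [Nat.cast_zero, zero_mul, mul_zero, zero_add]
  refine tsum_congr (fun n => ?_)
  push_cast
  try simp only [Nat.add_sub_cancel]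
  ring

noncomputable def cA (n : ℕ) : ℝ := (-1 : ℝ) ^ n / ((n.factorial : ℝ)) ^ 2
noncomputable def cC (n : ℕ) : ℝ := (-1 : ℝ) ^ n / ((n.factorial : ℝ) * ((n + 1).factorial : ℝ))
noncomputable def cB (n : ℕ) : ℝ := if n = 0 then 0 else cC (n - 1)
noncomputable def fA (y : ℝ) : ℝ := ∑' n, cA n * y ^ n
noncomputable def fB (y : ℝ) : ℝ := ∑' n, cB n * y ^ n
noncomputable def fC (y : ℝ) : ℝ := ∑' n, cC n * y ^ n

lemma fact_one_le (n : ℕ) : (1 : ℝ) ≤ (n.factorial : ℝ) := by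
  exact_mod_cast Nat.succ_le_of_lt (Nat.factorial_pos n)

lemma cA_le (n : ℕ) : |cA n| ≤ 1 / (n.factorial : ℝ) := by
  have := fact_one_le n
  rw [cA, abs_div, abs_pow, abs_neg, abs_one, one_pow, abs_of_nonneg (by positivity)]
  apply one_div_le_one_div_of_le (by positivity)
  nlinarith

lemma cC_le' (n : ℕ) : |cC n| ≤ 1 / ((n + 1).factorial : ℝ) := by
  have := fact_one_le n
  have := fact_one_le (n + 1)
  rw [cC, abs_div, abs_pow, abs_neg, abs_one, one_pow, abs_of_nonneg (by positivity)]
  apply one_div_le_one_div_of_le (by positivity)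
  nlinarith

lemma cC_le (n : ℕ) : |cC n| ≤ 1 / (n.factorial : ℝ) := by
  refine (cC_le' n).trans ?_
  apply one_div_le_one_div_of_le (by positivity)
  exact_mod_cast Nat.factorial_le (Nat.le_succ n)

lemma cB_le (n : ℕ) : |cB n| ≤ 1 / (n.factorial : ℝ) := by
  rcases n with _ | n
  · simp [cB]
  · simpa [cB] using cC_le' n

lemma fA_deriv (y : ℝ) : HasDerivAt fA (-fC y) y := by
  have h := aux_deriv cA cA_le y
  refine h.congr_deriv ?_
  symm
  rw [fC, ← tsum_neg]
  refine tsum_congr (fun n => ?_)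
  rw [cA, cC, Nat.factorial_succ]
  push_cast
  have : ((n : ℝ) + 1) ≠ 0 := by positivity
  have h2 : (n.factorial : ℝ) ≠ 0 := by positivity
  field_simp
  ring

lemma fB_deriv (y : ℝ) : HasDerivAt fB (fA y) y := by
  have h := aux_deriv cB cB_le y
  refine h.congr_deriv ?_
  symm
  rw [fA]
  refine tsum_congr (fun n => ?_)
  simp only [cB, cA, cC, Nat.factorial_succ, Nat.add_sub_cancel, Nat.add_eq_zero_iff, one_ne_zero,
    and_false, if_false]
  push_cast
  have : ((n : ℝ) + 1) ≠ 0 := by positivity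
  have h2 : (n.factorial : ℝ) ≠ 0 := by positivity
  field_simp

lemma fB_eq (y : ℝ) : fB y = y * fC y := by
  rw [fB, (aux_summable cB cB_le y).tsum_eq_zero_add, fC, ← tsum_mul_left]
  simp only [cB, if_true, zero_mul, zero_add]
  refine tsum_congr (fun n => ?_)
  simp [pow_succ]
  ring

lemma J0_eq (x : ℝ) : besselJ0 x = fA (x ^ 2 / 4) := by
  rw [besselJ0, fA]
  refine tsum_congr (fun n => ?_)
  rw [cA, pow_mul, div_pow]
  norm_num
  ring

lemma J1_eq (x : ℝ) : besselJ1 x = x / 2 * fC (x ^ 2 / 4) := by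
  rw [besselJ1, fC, ← tsum_mul_left]
  refine tsum_congr (fun n => ?_)
  rw [cC, pow_succ, pow_mul, div_pow]
  norm_num
  ring

lemma J0_deriv (x : ℝ) : HasDerivAt besselJ0 (-besselJ1 x) x := by
  have h : besselJ0 = fun x => fA (x ^ 2 / 4) := funext J0_eq
  rw [h, J1_eq]
  have h1 : HasDerivAt (fun x : ℝ => x ^ 2 / 4) (x / 2) x := by
    refine ((hasDerivAt_pow 2 x).div_const 4).congr_deriv ?_
    norm_num; ring
  refine ((fA_deriv (x ^ 2 / 4)).comp x h1).congr_deriv ?_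
  ring

lemma J1_deriv (x : ℝ) (hx : 0 < x) :
    HasDerivAt besselJ1 (besselJ0 x - besselJ1 x / x) x := by
  have h1 : HasDerivAt (fun x : ℝ => x ^ 2 / 4) (x / 2) x := by
    refine ((hasDerivAt_pow 2 x).div_const 4).congr_deriv ?_
    norm_num; ring
  have h2 : HasDerivAt (fun x => 2 * fB (x ^ 2 / 4) / x) (besselJ0 x - besselJ1 x / x) x := by
    refine ((((fB_deriv (x ^ 2 / 4)).comp x h1).const_mul 2).div (hasDerivAt_id x) hx.ne').congr_deriv ?_
    simp only [id, Function.comp, fB_eq, J0_eq, J1_eq]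
    field_simp
    ring
  refine h2.congr_of_eventuallyEq ?_
  filter_upwards [eventually_gt_nhds hx] with z hz
  rw [J1_eq, fB_eq]
  field_simp
  ring

/-- Sturm gap. -/
lemma gap (a b : ℝ) (ha : 0 < a) (hab : a < b) (hJa : besselJ1 a = 0) (hJb : besselJ1 b = 0)
    (hne : ∀ x, a < x → x < b → besselJ1 x ≠ 0) : a + 3 ≤ b := by
  by_contra hlt
  push Not at hlt
  set m := (a + b) / 2 with hm
  have hcos : ∀ x ∈ Set.Icc a b, Real.cos (x - m) ≠ 0 := by
    intro x hx
    have := Real.pi_gt_three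
    apply ne_of_gt
    apply Real.cos_pos_of_mem_Ioo
    constructor <;> linarith [hx.1, hx.2]
  set P : ℝ → ℝ := fun x => x * besselJ0 x * besselJ1 x - besselJ1 x ^ 2 / 2
    + x * besselJ1 x ^ 2 * Real.tan (x - m) with hP
  have hd : ∀ x ∈ Set.Icc a b, HasDerivAt P
      (x * (besselJ0 x - besselJ1 x / (2 * x) + besselJ1 x * Real.tan (x - m)) ^ 2
        + 3 / (4 * x) * besselJ1 x ^ 2) x := by
    intro x hx
    have hx0 : 0 < x := ha.trans_le hx.1
    have d0 := J0_deriv x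
    have d1 := J1_deriv x hx0
    have dt : HasDerivAt (fun x => Real.tan (x - m)) (1 + Real.tan (x - m) ^ 2) x := by
      have := (Real.hasDerivAt_tan (hcos x hx)).comp x ((hasDerivAt_id x).sub_const m)
      refine this.congr_deriv ?_
      rw [Real.tan_eq_sin_div_cos]
      have h3 := Real.sin_sq_add_cos_sq (x - m)
      have h4 := hcos x hx
      simp only [mul_one]
      field_simp
      linarith
    have := ((((hasDerivAt_id x).mul d0).mul d1).sub ((d1.pow 2).div_const 2)).add
      (((hasDerivAt_id x).mul (d1.pow 2)).mul dt)
    refine this.congr_deriv ?_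
    simp only [id, Pi.mul_apply, Pi.pow_apply]
    field_simp
    ring
  have hmono : StrictMonoOn P (Set.Icc a b) := by
    apply strictMonoOn_of_deriv_pos (convex_Icc a b)
    · intro x hx; exact (hd x hx).continuousAt.continuousWithinAt
    · intro x hx
      rw [interior_Icc] at hx
      rw [(hd x ⟨hx.1.le, hx.2.le⟩).deriv]
      have hx0 : 0 < x := ha.trans hx.1
      have := hne x hx.1 hx.2
      positivity
  have := hmono (Set.left_mem_Icc.2 hab.le) (Set.right_mem_Icc.2 hab.le) hab
  simp [hP, hJa, hJb] at this

noncomputable def GG (x : ℝ) : ℝ := x * (besselJ0 x ^ 2 + besselJ1 x ^ 2) - besselJ0 x * besselJ1 x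
  + besselJ0 x ^ 2 / (2 * x)

lemma GG_anti : AntitoneOn GG (Set.Ici 2) := by
  have hd : ∀ x : ℝ, 0 < x → HasDerivAt GG (-(besselJ0 x ^ 2 / (2 * x ^ 2))) x := by
    intro x hx0
    have d0 := J0_deriv x
    have d1 := J1_deriv x hx0
    have := (((hasDerivAt_id x).mul ((d0.pow 2).add (d1.pow 2))).sub (d0.mul d1)).add
      ((d0.pow 2).div ((hasDerivAt_id x).const_mul 2) (by simp; exact hx0.ne'))
    refine this.congr_deriv ?_
    simp only [id, Pi.mul_apply, Pi.pow_apply, Pi.add_apply]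
    field_simp
    ring
  apply antitoneOn_of_deriv_nonpos (convex_Ici 2)
  · intro x hx
    exact (hd x (by linarith [Set.mem_Ici.1 hx])).continuousAt.continuousWithinAt
  · intro x hx
    rw [interior_Ici] at hx
    exact (hd x (by linarith [Set.mem_Ioi.1 hx])).differentiableAt.differentiableWithinAt
  · intro x hx
    rw [interior_Ici] at hx
    rw [(hd x (by linarith [Set.mem_Ioi.1 hx])).deriv]
    have : 0 ≤ besselJ0 x ^ 2 / (2 * x ^ 2) := by positivity
    linarith

/-- alternating lower bound -/
lemma alt_ge (t : ℕ → ℝ) (hs : Summable t) (N : ℕ)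
    (h : ∀ k, 0 ≤ t (N + 2 * k) + t (N + 2 * k + 1)) :
    ∑ i ∈ Finset.range N, t i ≤ ∑' i, t i := by
  rw [← hs.sum_add_tsum_nat_add N]
  have hs' : Summable (fun i => t (i + N)) := (summable_nat_add_iff N).2 hs
  have he : Summable (fun k => t (2 * k + N)) :=
    hs.comp_injective (i := fun k : ℕ => 2 * k + N) (fun a b h => by
      have h : 2 * a + N = 2 * b + N := h
      omega)
  have ho : Summable (fun k => t (2 * k + 1 + N)) :=
    hs.comp_injective (i := fun k : ℕ => 2 * k + 1 + N) (fun a b h => by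
      have h : 2 * a + 1 + N = 2 * b + 1 + N := h
      omega)
  rw [← tsum_even_add_odd (f := fun i => t (i + N)) he ho, ← he.tsum_add ho]
  have : 0 ≤ ∑' k, (t (2 * k + N) + t (2 * k + 1 + N)) := by
    apply tsum_nonneg
    intro k
    have h1 := h k
    have e1 : 2 * k + N = N + 2 * k := by omega
    have e2 : 2 * k + 1 + N = N + 2 * k + 1 := by omega
    rw [e1, e2]
    exact h1
  linarith

lemma cC_step (n : ℕ) : cC (n + 1) = - cC n / (((n : ℝ) + 1) * ((n : ℝ) + 2)) := by
  simp only [cC, Nat.factorial_succ, pow_succ]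
  push_cast
  have h2 : (n.factorial : ℝ) ≠ 0 := by positivity
  have h3 : (n : ℝ) + 1 + 1 = (n : ℝ) + 2 := by ring
  rw [h3]
  field_simp

lemma cA_step (n : ℕ) : cA (n + 1) = - cA n / ((n : ℝ) + 1) ^ 2 := by
  simp only [cA, Nat.factorial_succ, pow_succ]
  push_cast
  have h2 : (n.factorial : ℝ) ≠ 0 := by positivity
  field_simp

lemma fC_ge (y : ℝ) (hy : 0 ≤ y) (hy3 : y ≤ 3) : ∑ i ∈ Finset.range 4, cC i * y ^ i ≤ fC y := by
  apply alt_ge _ (aux_summable cC cC_le y)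
  intro k
  have h1 : 0 ≤ cC (4 + 2 * k) := by
    rw [cC, Even.neg_one_pow ⟨2 + k, by ring⟩]; positivity
  rw [cC_step, pow_succ]
  set n : ℝ := ((4 + 2 * k : ℕ) : ℝ) with hn
  have hn4 : 4 ≤ n := by rw [hn]; push_cast; linarith [Nat.cast_nonneg (α := ℝ) k]
  have : cC (4 + 2 * k) * y ^ (4 + 2 * k) + -cC (4 + 2 * k) / ((n + 1) * (n + 2)) *
      (y ^ (4 + 2 * k) * y) = cC (4 + 2 * k) * y ^ (4 + 2 * k) * (1 - y / ((n + 1) * (n + 2))) := by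
    ring
  rw [this]
  apply mul_nonneg (by positivity)
  rw [sub_nonneg, div_le_one (by positivity)]
  nlinarith

lemma fC_pos (y : ℝ) (hy : 0 ≤ y) (hy3 : y ≤ 3) : 0 < fC y := by
  refine lt_of_lt_of_le ?_ (fC_ge y hy hy3)
  simp [Finset.sum_range_succ, cC, Nat.factorial]
  nlinarith [mul_nonneg hy (sub_nonneg.2 hy3), mul_nonneg (mul_nonneg hy hy) (sub_nonneg.2 hy3),
    mul_nonneg (mul_nonneg hy (sub_nonneg.2 hy3)) (sub_nonneg.2 hy3), sq_nonneg (y - 3),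
    mul_nonneg (sub_nonneg.2 hy3) (sq_nonneg (y - 3))]

lemma fC_one_ge : 0.576 ≤ fC 1 := by
  refine le_trans ?_ (fC_ge 1 (by norm_num) (by norm_num))
  simp [Finset.sum_range_succ, cC, Nat.factorial]
  norm_num

lemma fC_one_le : fC 1 ≤ 0.577 := by
  have := alt_ge (fun n => - (cC n * 1 ^ n)) (aux_summable cC cC_le 1).neg 5 (by
    intro k
    have h1 : cC (5 + 2 * k) ≤ 0 := by
      rw [cC, Odd.neg_one_pow ⟨2 + k, by ring⟩, neg_div]
      apply neg_nonpos.2; positivity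
    rw [cC_step, one_pow, one_pow]
    set n : ℝ := ((5 + 2 * k : ℕ) : ℝ) with hn
    have hn4 : 5 ≤ n := by rw [hn]; push_cast; linarith [Nat.cast_nonneg (α := ℝ) k]
    have : -(cC (5 + 2 * k) * 1) + -(-cC (5 + 2 * k) / ((n + 1) * (n + 2)) * 1)
      = -cC (5 + 2 * k) * (1 - 1 / ((n + 1) * (n + 2))) := by ring
    rw [this]
    apply mul_nonneg (by linarith)
    rw [sub_nonneg, div_le_one (by positivity)]
    nlinarith)
  rw [tsum_neg] at this
  change _ ≤ - fC 1 at this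
  simp [Finset.sum_range_succ, cC, Nat.factorial] at this
  norm_num at this ⊢
  linarith

lemma fA_one_ge : 0.222 ≤ fA 1 := by
  have := alt_ge (fun n => (cA n * 1 ^ n)) (aux_summable cA cA_le 1) 4 (by
    intro k
    have h1 : 0 ≤ cA (4 + 2 * k) := by
      rw [cA, Even.neg_one_pow ⟨2 + k, by ring⟩]
      positivity
    rw [cA_step, one_pow, one_pow]
    set n : ℝ := ((4 + 2 * k : ℕ) : ℝ) with hn
    have hn4 : 4 ≤ n := by rw [hn]; push_cast; linarith [Nat.cast_nonneg (α := ℝ) k]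
    have : (cA (4 + 2 * k) * 1) + (-cA (4 + 2 * k) / (n + 1) ^ 2 * 1)
      = cA (4 + 2 * k) * (1 - 1 / (n + 1) ^ 2) := by ring
    rw [this]
    apply mul_nonneg (by linarith)
    rw [sub_nonneg, div_le_one (by positivity)]
    nlinarith)
  change _ ≤ fA 1 at this
  simp [Finset.sum_range_succ, cA, Nat.factorial] at this
  norm_num at this ⊢
  linarith

lemma fA_one_le : fA 1 ≤ 0.224 := by
  have := alt_ge (fun n => - (cA n * 1 ^ n)) (aux_summable cA cA_le 1).neg 5 (by
    intro k
    have h1 : cA (5 + 2 * k) ≤ 0 := by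
      rw [cA, Odd.neg_one_pow ⟨2 + k, by ring⟩, neg_div]
      apply neg_nonpos.2; positivity
    rw [cA_step, one_pow, one_pow]
    set n : ℝ := ((5 + 2 * k : ℕ) : ℝ) with hn
    have hn4 : 5 ≤ n := by rw [hn]; push_cast; linarith [Nat.cast_nonneg (α := ℝ) k]
    have : -(cA (5 + 2 * k) * 1) + -(-cA (5 + 2 * k) / (n + 1) ^ 2 * 1)
      = -cA (5 + 2 * k) * (1 - 1 / (n + 1) ^ 2) := by ring
    rw [this]
    apply mul_nonneg (by linarith)
    rw [sub_nonneg, div_le_one (by positivity)]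
    nlinarith)
  rw [tsum_neg] at this
  change _ ≤ - fA 1 at this
  simp [Finset.sum_range_succ, cA, Nat.factorial] at this
  norm_num at this ⊢
  linarith

lemma GG_two : GG 2 ≤ 0.66 := by
  have h0 : besselJ0 2 = fA 1 := by rw [J0_eq]; norm_num
  have h1 : besselJ1 2 = fC 1 := by rw [J1_eq]; norm_num
  rw [GG, h0, h1]
  have a1 := fA_one_ge
  have a2 := fA_one_le
  have c1 := fC_one_ge
  have c2 := fC_one_le
  have e1 : fA 1 ^ 2 ≤ 0.224 ^ 2 := by gcongr
  have e2 : fC 1 ^ 2 ≤ 0.577 ^ 2 := by gcongr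
  have e3 : 0.222 * 0.576 ≤ fA 1 * fC 1 := by gcongr
  norm_num at *
  linarith

lemma term_bound (n : ℕ) (x : ℝ) (hx : 3.4 + 6 * (n : ℝ) ≤ x) (h : besselJ1 x = 0) :
    |besselJ0 x| ^ 6 ≤ (0.66 / (3.4 + 6 * (n : ℝ))) ^ 3 := by
  have hn : (0 : ℝ) ≤ n := Nat.cast_nonneg n
  have hx0 : 0 < x := by norm_num at hx; linarith
  have hx2 : 2 ≤ x := by norm_num at hx; linarith
  have hG := (GG_anti (Set.mem_Ici.2 le_rfl) (Set.mem_Ici.2 hx2) hx2).trans GG_two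
  rw [GG, h] at hG
  have h3 : 0 ≤ besselJ0 x ^ 2 / (2 * x) := by positivity
  have h4 : x * besselJ0 x ^ 2 ≤ 0.66 := by nlinarith
  have h5 : besselJ0 x ^ 2 ≤ 0.66 / (3.4 + 6 * (n : ℝ)) := by
    rw [le_div_iff₀ (by positivity)]
    nlinarith [sq_nonneg (besselJ0 x)]
  calc |besselJ0 x| ^ 6 = (besselJ0 x ^ 2) ^ 3 := by rw [← sq_abs]; ring
    _ ≤ _ := by gcongr

/-- The series $Σ_{i≥1} i |J_0(j_{2i-1})|^6$ converges and is $< 2/(21π²)$. -/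
theorem bessel_series_lt
    (j : ℕ → ℝ)
    (hjpos : ∀ i, 1 ≤ i → 0 < j i)
    (hjzero : ∀ i, 1 ≤ i → besselJ1 (j i) = 0)
    (hjmono : ∀ i k, 1 ≤ i → i < k → j i < j k)
    (hjall : ∀ x : ℝ, 0 < x → besselJ1 x = 0 → ∃ i, 1 ≤ i ∧ x = j i) :
    Summable (fun i : ℕ => ((i : ℝ) + 1) * |besselJ0 (j (2 * i + 1))| ^ 6) ∧
      ∑' i : ℕ, ((i : ℝ) + 1) * |besselJ0 (j (2 * i + 1))| ^ 6 <
        2 / (21 * Real.pi ^ 2) := by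
  have hgap : ∀ i, 1 ≤ i → j i + 3 ≤ j (i + 1) := by
    intro i hi
    refine gap _ _ (hjpos i hi) (hjmono i (i + 1) hi (by omega)) (hjzero i hi)
      (hjzero (i + 1) (by omega)) ?_
    intro x h1 h2 h0
    obtain ⟨k, hk, rfl⟩ := hjall x ((hjpos i hi).trans h1) h0
    rcases le_or_gt k i with hki | hki
    · rcases hki.eq_or_lt with rfl | hki
      · exact lt_irrefl _ h1
      · exact lt_asymm h1 (hjmono k i hk hki)
    · rcases (Nat.succ_le_of_lt hki).eq_or_lt with h | h
      · rw [← h] at h2; exact lt_irrefl _ h2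
      · exact lt_asymm h2 (hjmono (i + 1) k (by omega) h)
  have hlow : ∀ n : ℕ, 3.4 + 6 * (n : ℝ) ≤ j (2 * n + 1) := by
    intro n
    induction n with
    | zero =>
      by_contra hlt
      push Not at hlt
      have h0 := hjpos 1 le_rfl
      have hz := hjzero 1 le_rfl
      norm_num at hlt
      rw [J1_eq] at hz
      have := fC_pos (j 1 ^ 2 / 4) (by positivity) (by nlinarith)
      have : 0 < j 1 / 2 * fC (j 1 ^ 2 / 4) := by positivity
      linarith
    | succ n ih =>
      have h1 := hgap (2 * n + 1) (by omega)
      have h2 := hgap (2 * n + 1 + 1) (by omega)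
      have : 2 * (n + 1) + 1 = 2 * n + 1 + 1 + 1 := by ring
      rw [this]
      push_cast
      linarith
  set t : ℕ → ℝ := fun i : ℕ => ((i : ℝ) + 1) * |besselJ0 (j (2 * i + 1))| ^ 6 with ht
  have htn : ∀ n, 0 ≤ t n := fun n => by simp only [ht]; positivity
  have hb : ∀ n, t n ≤ ((n : ℝ) + 1) * (0.66 / (3.4 + 6 * (n : ℝ))) ^ 3 := by
    intro n
    simp only [ht]
    gcongr
    exact term_bound n _ (hlow n) (hjzero _ (by omega))
  have hsum : ∀ N : ℕ, ∑ i ∈ Finset.range (N + 1), t i ≤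
      0.00732 + 0.0016 * (1 - 1 / ((N : ℝ) + 1)) := by
    intro N
    induction N with
    | zero =>
      have := hb 0
      norm_num at this ⊢
      linarith
    | succ n ih =>
      rw [Finset.sum_range_succ]
      have h1 := hb (n + 1)
      have h2 : (((n + 1 : ℕ) : ℝ) + 1) * (0.66 / (3.4 + 6 * ((n + 1 : ℕ) : ℝ))) ^ 3 ≤
          0.0016 * (1 / ((n : ℝ) + 1) - 1 / (((n + 1 : ℕ) : ℝ) + 1)) := by
        push_cast
        have hn : (0 : ℝ) ≤ n := Nat.cast_nonneg n
        have e : (0.0016 : ℝ) * (1 / ((n : ℝ) + 1) - 1 / ((n : ℝ) + 1 + 1)) =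
          0.0016 / (((n : ℝ) + 1) * ((n : ℝ) + 1 + 1)) := by
          field_simp; ring
        rw [e, div_pow, ← mul_div_assoc, div_le_div_iff₀ (by positivity) (by positivity)]
        have p2 : 0 ≤ (n : ℝ) ^ 2 := by positivity
        have p3 : 0 ≤ (n : ℝ) ^ 3 := by positivity
        norm_num
        ring_nf
        nlinarith
      linarith
  have hsum' : ∀ N : ℕ, ∑ i ∈ Finset.range N, t i ≤ 0.00892 := by
    intro N
    have h1 := hsum N
    rw [Finset.sum_range_succ] at h1
    have h2 := htn N
    have h3 : 0 ≤ 1 / ((N : ℝ) + 1) := by positivity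
    have h4 : 0.0016 * (1 - 1 / ((N : ℝ) + 1)) ≤ 0.0016 := by linarith
    have h5 : (0.00732 : ℝ) + 0.0016 = 0.00892 := by norm_num
    linarith
  refine ⟨summable_of_sum_range_le htn hsum', ?_⟩
  refine lt_of_le_of_lt (Real.tsum_le_of_sum_range_le htn hsum') ?_
  have h1 := Real.pi_lt_d2
  have h2 := Real.pi_pos
  rw [lt_div_iff₀ (by positivity)]
  have : Real.pi ^ 2 < 3.15 ^ 2 := by gcongr
  norm_num at *
  linarith
end
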